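/- arXiv:1701.08321 — 3 statements merged into one kernel-verified Lean document; each statement's English description precedes it below -/
import Mathlib

section
/- If A is a finite geometrically proper set of positive bump functions in Homeo₊(I), then the maximal stretched transition chains of A partition the nonisolated elements of A: every nonisolated element of A belongs to exactly one maximal stretched transition chain of A. -/
open Set

/-- The unit interval `[0,1]` as a type. -/
abbrev UI : Type := ↥unitInterval

/-- Bijections of the unit interval; orientation-preserving homeomorphisms are
exactly the monotone ones among these. -/
abbrev Homeo01 : Type := Equiv.Perm UI

namespace PingPong

/-- The support of `f`. -/
def supt (f : Homeo01) : Set UI := {t | f t ≠ t}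

/-- `f` is an orientation-preserving homeomorphism of `[0,1]`:
a monotone bijection of `[0,1]` (automatically a homeomorphism). -/
def IsOPH (f : Homeo01) : Prop := Monotone ⇑f

/-- A bump function: an orientation preserving homeomorphism with exactly one
orbital, i.e. whose support is nonempty and connected. -/
def IsBump (f : Homeo01) : Prop := IsOPH f ∧ IsConnected (supt f)

/-- A positive bump function. -/
def IsPosBump (f : Homeo01) : Prop := IsBump f ∧ ∀ t ∈ supt f, t < f t

/-- The source of a positive bump `a` with marker `t`. -/
def src (a : Homeo01) (t : UI) : Set UI := {s ∈ supt a | s < t}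

/-- The destination of a positive bump `a` with marker `t`. -/
def dest (a : Homeo01) (t : UI) : Set UI := {s ∈ supt a | a t ≤ s}

/-- `m` is a marking of the collection `A` of bumps. -/
def IsMarking (A : Set Homeo01) (m : Homeo01 → UI) : Prop := ∀ a ∈ A, m a ∈ supt a

/-- The feet of a marked bump: `false` gives the source, `true` the destination. -/
def foot (a : Homeo01) (t : UI) : Bool → Set UI
  | false => src a t
  | true => dest a t

/-- The feet of the marked family `(A, m)` are pairwise disjoint. -/
def FeetDisjoint (A : Set Homeo01) (m : Homeo01 → UI) : Prop :=
  ∀ a ∈ A, ∀ b ∈ A, ∀ i j : Bool, (a, i) ≠ (b, j) →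
    Disjoint (foot a (m a) i) (foot b (m b) j)

/-- A geometrically fast collection of (positive) bumps. -/
def FastBumps (A : Set Homeo01) : Prop :=
  (∀ a ∈ A, IsPosBump a) ∧ ∃ m : Homeo01 → UI, IsMarking A m ∧ FeetDisjoint A m

/-- `t` is a left transition point of `f`. -/
def IsLeftTransition (f : Homeo01) (t : UI) : Prop :=
  t ∉ supt f ∧ ∀ ε : ℝ, 0 < ε → ∃ s ∈ supt f, t < s ∧ (s : ℝ) < (t : ℝ) + ε

/-- `t` is a right transition point of `f`. -/
def IsRightTransition (f : Homeo01) (t : UI) : Prop :=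
  t ∉ supt f ∧ ∀ ε : ℝ, 0 < ε → ∃ s ∈ supt f, s < t ∧ (t : ℝ) - ε < (s : ℝ)

/-- `t` is a transition point of `f`. -/
def IsTransition (f : Homeo01) (t : UI) : Prop :=
  IsLeftTransition f t ∨ IsRightTransition f t

/-- A geometrically proper set of homeomorphisms. -/
def GeomProper (X : Set Homeo01) : Prop :=
  (∀ f ∈ X, ∀ g ∈ X, f ≠ g → ∀ t : UI, ¬(IsLeftTransition f t ∧ IsLeftTransition g t)) ∧
  (∀ f ∈ X, ∀ g ∈ X, f ≠ g → ∀ t : UI, ¬(IsRightTransition f t ∧ IsRightTransition g t))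

/-- The positive bump `a` is used in `f`. -/
def UsedIn (f a : Homeo01) : Prop :=
  IsPosBump a ∧ (Set.EqOn ⇑f ⇑a (supt a) ∨ Set.EqOn ⇑f ⇑a⁻¹ (supt a))

/-- The set of (positive) bumps used in `X`. -/
def usedBumps (X : Set Homeo01) : Set Homeo01 := {a | ∃ f ∈ X, UsedIn f a}

/-- A geometrically fast set of homeomorphisms. -/
def GeomFast (X : Set Homeo01) : Prop := GeomProper X ∧ FastBumps (usedBumps X)

/-- The set of transition points of elements of `X`. -/
def transitionPoints (X : Set Homeo01) : Set UI := {t | ∃ f ∈ X, IsTransition f t}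

/-! ### Words -/

/-- A word in the alphabet `A^± = A ∪ A⁻¹`, recorded as a list of the permutations
represented by its symbols (for a set `A` of positive bumps this is faithful,
since `A ∩ A⁻¹ = ∅`). -/
def WordOn (A : Set Homeo01) (w : List Homeo01) : Prop := ∀ x ∈ w, x ∈ A ∨ x⁻¹ ∈ A

/-- A freely reduced word: no symbol is immediately followed by its inverse. -/
def FreelyReduced (w : List Homeo01) : Prop := List.Chain' (fun a b => b ≠ a⁻¹) w

/-- The right action of a word on a point: apply the symbols from left to right. -/
def act (t : UI) (w : List Homeo01) : UI := w.foldl (fun s a => a s) t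

/-- `w` is locally reduced at `t`. -/
def LocallyReducedAt (w : List Homeo01) (t : UI) : Prop :=
  FreelyReduced w ∧ ∀ (u : List Homeo01) (a : Homeo01), u ++ [a] <+: w → a (act t u) ≠ act t u

open Classical in
/-- The source of a symbol of `A^±`: for `a ∈ A` it is `src a`, and for the
formal inverse of an element of `A` it is the destination of that element. -/
noncomputable def symSrc (A : Set Homeo01) (m : Homeo01 → UI) (b : Homeo01) : Set UI :=
  if b ∈ A then src b (m b) else dest b⁻¹ (m b⁻¹)

open Classical in
/-- The destination of a symbol of `A^±`. -/
noncomputable def symDest (A : Set Homeo01) (m : Homeo01 → UI) (b : Homeo01) : Set UI :=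
  if b ∈ A then dest b (m b) else src b⁻¹ (m b⁻¹)

/-- The source of a word: the source of its first symbol (empty for the empty word). -/
noncomputable def wordSrc (A : Set Homeo01) (m : Homeo01 → UI) : List Homeo01 → Set UI
  | [] => ∅
  | a :: _ => symSrc A m a

/-- The destination of a word: the destination of its last symbol. -/
noncomputable def wordDest (A : Set Homeo01) (m : Homeo01 → UI) (w : List Homeo01) : Set UI :=
  match w.getLast? with
  | none => ∅
  | some a => symDest A m a

/-- `J(w) = supt(a) \ src(a)` where `a` is the first symbol of `w`. -/
noncomputable def Jset (A : Set Homeo01) (m : Homeo01 → UI) : List Homeo01 → Set UI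
  | [] => ∅
  | a :: _ => supt a \ symSrc A m a

/-- `t` has trivial history: it lies in no foot of any element of `A`. -/
def TrivialHistory (A : Set Homeo01) (m : Homeo01 → UI) (t : UI) : Prop :=
  ∀ a ∈ A, t ∉ src a (m a) ∧ t ∉ dest a (m a)

/-- `x` has finite history: there is a finite bound on the lengths of `A`-words
locally reduced at `x` whose evaluation at `x` is outside their destination. -/
def FiniteHistory (A : Set Homeo01) (m : Homeo01 → UI) (x : UI) : Prop :=
  ∃ n : ℕ, ∀ w : List Homeo01, WordOn A w → LocallyReducedAt w x →
    act x w ∉ wordDest A m w → w.length ≤ n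

/-- A return word for `x`. -/
def IsReturnWord (x : UI) (w : List Homeo01) : Prop := w ≠ [] ∧ act x w = x

/-- `w` has a return prefix for `x`. -/
def HasReturnPrefix (x : UI) (w : List Homeo01) : Prop :=
  ∃ v : List Homeo01, v <+: w ∧ IsReturnWord x v

/-- The set of initial markers of the marked family `(A, m)`. -/
def initialMarkers (A : Set Homeo01) (m : Homeo01 → UI) : Set UI :=
  {t | (∃ a ∈ A, m a = t) ∧ ∀ b ∈ A, m b < t → b (m b) ≠ t}

/-- `M⟨X⟩`: the orbit of the set of initial markers of `(A, m)` under the group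
generated by `X`. -/
def MOrbit (A : Set Homeo01) (m : Homeo01 → UI) (X : Set Homeo01) : Set UI :=
  {u | ∃ t ∈ initialMarkers A m, ∃ g ∈ Subgroup.closure X, g t = u}

end PingPong
namespace PingPong

/-! ### Piecewise linear maps and Thompson's group F -/

/-- `f` is piecewise linear (finitely many affine pieces). -/
def IsPL (f : Homeo01) : Prop :=
  ∃ (n : ℕ) (t : Fin (n + 1) → ℝ), StrictMono t ∧ t 0 = 0 ∧ t (Fin.last n) = 1 ∧
    ∀ i : Fin n, ∃ c d : ℝ, ∀ s : UI,
      t i.castSucc ≤ (s : ℝ) → (s : ℝ) ≤ t i.succ → ((f s : ℝ)) = c * (s : ℝ) + d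

/-- `x` is a dyadic rational. -/
def IsDyadic (x : ℝ) : Prop := ∃ (a : ℤ) (k : ℕ), x = (a : ℝ) / 2 ^ k

/-- `f` belongs to Thompson's group `F`: an orientation-preserving piecewise linear
homeomorphism of `[0,1]` with dyadic breakpoints and slopes integer powers of `2`. -/
def InThompsonF (f : Homeo01) : Prop :=
  IsOPH f ∧
  ∃ (n : ℕ) (t : Fin (n + 1) → ℝ), StrictMono t ∧ t 0 = 0 ∧ t (Fin.last n) = 1 ∧
    (∀ i, IsDyadic (t i)) ∧
    ∀ i : Fin n, ∃ (k : ℤ) (d : ℝ), ∀ s : UI,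
      t i.castSucc ≤ (s : ℝ) → (s : ℝ) ≤ t i.succ → ((f s : ℝ)) = (2 : ℝ) ^ k * (s : ℝ) + d

/-! ### Stretched transition chains -/

/-- `a` is isolated in `A`: its support contains no transition point of an element of `A`. -/
def IsolatedIn (A : Set Homeo01) (a : Homeo01) : Prop :=
  ∀ t ∈ supt a, ∀ b ∈ A, ¬ IsTransition b t

/-- `c` (with supports `(x i, y i)`) is a stretched transition chain of `A`. -/
def IsSTC (A : Set Homeo01) (k : ℕ) (c : Fin (k + 1) → Homeo01)
    (x y : Fin (k + 1) → ℝ) : Prop :=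
  (∀ i, c i ∈ A ∧ ¬ IsolatedIn A (c i)) ∧
  (∀ i, supt (c i) = {t : UI | x i < (t : ℝ) ∧ (t : ℝ) < y i}) ∧
  (∀ i : Fin k, x i.castSucc < x i.succ ∧ x i.succ < y i.castSucc ∧ y i.castSucc < y i.succ) ∧
  (∀ i : Fin k, ∀ t : UI, x i.succ < (t : ℝ) → (t : ℝ) < y i.castSucc →
    ∀ b ∈ A, ¬ IsTransition b t)

/-- `S` is the underlying set of some stretched transition chain of `A`. -/
def ChainSet (A : Set Homeo01) (S : Set Homeo01) : Prop :=
  ∃ (k : ℕ) (c : Fin (k + 1) → Homeo01) (x y : Fin (k + 1) → ℝ),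
    IsSTC A k c x y ∧ S = Set.range c

/-- `S` is the underlying set of a maximal stretched transition chain of `A`. -/
def MaxChainSet (A : Set Homeo01) (S : Set Homeo01) : Prop :=
  ChainSet A S ∧ ∀ S' : Set Homeo01, ChainSet A S' → S ⊆ S' → S = S'

/-- The transition points of `A` lying in the support of the chain `c`. -/
def chainTrans (A : Set Homeo01) (k : ℕ) (c : Fin (k + 1) → Homeo01) : Set UI :=
  {t | (∃ i, t ∈ supt (c i)) ∧ ∃ b ∈ A, IsTransition b t}

/-- The image of `t` under the composition `∏ C = c 0 ⋯ c k`. -/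
def chainApply (k : ℕ) (c : Fin (k + 1) → Homeo01) (t : UI) : UI :=
  (List.ofFn c).foldl (fun s a => a s) t

/-! ### Dynamical diagrams -/

/-- The collection of feet of the bumps used in `X`, with marking `m`. -/
def Feet (X : Set Homeo01) (m : Homeo01 → UI) : Set (Set UI) :=
  {S | ∃ a ∈ usedBumps X, S = src a (m a) ∨ S = dest a (m a)}

/-- The signed bumps of `f`: bumps agreeing with `f` on their support. -/
def signedBumps (f : Homeo01) : Set Homeo01 :=
  {b | IsBump b ∧ Set.EqOn ⇑b ⇑f (supt b)}

open Classical in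
/-- The source of a signed bump, with respect to the marking `m` of the positive bumps. -/
noncomputable def sSrc (m : Homeo01 → UI) (b : Homeo01) : Set UI :=
  if IsPosBump b then src b (m b) else dest b⁻¹ (m b⁻¹)

open Classical in
/-- The destination of a signed bump, with respect to the marking `m` of the positive bumps. -/
noncomputable def sDest (m : Homeo01 → UI) (b : Homeo01) : Set UI :=
  if IsPosBump b then dest b (m b) else src b⁻¹ (m b⁻¹)

/-- An isomorphism of the dynamical diagrams of the marked families `(X, mX)` and
`(Y, mY)`, inducing the bijection `τ : X → Y`: an order-preserving bijection `Φ`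
between the collections of feet, together with, for each `f ∈ X`, a bijection of the
signed bumps of `f` with those of `τ f` under which `Φ` matches sources with sources
and destinations with destinations. -/
def DiagIso (X : Set Homeo01) (mX : Homeo01 → UI) (Y : Set Homeo01) (mY : Homeo01 → UI)
    (τ : Homeo01 → Homeo01) : Prop :=
  Set.BijOn τ X Y ∧
  ∃ Φ : Set UI → Set UI,
    Set.BijOn Φ (Feet X mX) (Feet Y mY) ∧
    (∀ S ∈ Feet X mX, ∀ T ∈ Feet X mX,
      (∀ s ∈ S, ∀ t ∈ T, s < t) → ∀ s ∈ Φ S, ∀ t ∈ Φ T, s < t) ∧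
    ∀ f ∈ X, ∃ β : Homeo01 → Homeo01,
      Set.BijOn β (signedBumps f) (signedBumps (τ f)) ∧
      ∀ b ∈ signedBumps f, Φ (sSrc mX b) = sSrc mY (β b) ∧ Φ (sDest mX b) = sDest mY (β b)

/-! ### Excision -/

/-- The union of the supports of the bumps of `E` used in `f`. -/
def quotSupp (f : Homeo01) (E : Set Homeo01) : Set UI :=
  {t | ∃ a ∈ E, UsedIn f a ∧ t ∈ supt a}

/-- `g = f/E`: `g` is the identity on the supports of the bumps of `E` used in `f`,
and agrees with `f` elsewhere. -/
def IsQuot (f : Homeo01) (E : Set Homeo01) (g : Homeo01) : Prop :=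
  (∀ t ∈ quotSupp f E, g t = t) ∧ ∀ t ∉ quotSupp f E, g t = f t

/-- `E` is extraneous in `X` (with respect to the marking `m`), witnessed by an
interval `J`. -/
def Extraneous (X : Set Homeo01) (m : Homeo01 → UI) (E : Set Homeo01) : Prop :=
  ∃ J : Set UI, J.OrdConnected ∧ ∃ f ∈ X,
    (∀ e ∈ E, UsedIn f e ∧ IsolatedIn (usedBumps X) e ∧ supt e ⊆ J) ∧
    (∃ a : Homeo01, UsedIn f a ∧ a ∉ E ∧ (src a (m a) ⊆ J ∨ dest a (m a) ⊆ J)) ∧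
    ∀ g ∈ X, g ≠ f → ∀ b : Homeo01, UsedIn g b →
      Disjoint (src b (m b)) J ∧ Disjoint (dest b (m b)) J

end PingPong
namespace PingPong

/-- The left endpoint of the support of `f`. -/
noncomputable def leftEnd (f : Homeo01) : ℝ := sInf ((↑) '' supt f)

/-- The right endpoint of the support of `f`. -/
noncomputable def rightEnd (f : Homeo01) : ℝ := sSup ((↑) '' supt f)

lemma symm_apply_mem_supt {f : Homeo01} {t : UI} (ht : t ∈ supt f) : f.symm t ∈ supt f := by
  intro he
  apply ht
  rw [Equiv.apply_symm_apply] at he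
  conv_lhs => rw [he]
  simp

lemma zero_notMem_supt {f : Homeo01} (hf : IsPosBump f) : (0 : UI) ∉ supt f := by
  intro h
  have h' := symm_apply_mem_supt h
  have := hf.2 _ h'
  rw [Equiv.apply_symm_apply] at this
  exact absurd this (not_lt.2 unitInterval.nonneg')

lemma one_notMem_supt {f : Homeo01} (hf : IsPosBump f) : (1 : UI) ∉ supt f := fun h =>
  absurd (hf.2 _ h) (not_lt.2 unitInterval.le_one')

lemma bddBelow_coe_image (s : Set UI) : BddBelow ((↑) '' s : Set ℝ) :=
  ⟨0, by rintro _ ⟨t, -, rfl⟩; exact t.2.1⟩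

lemma bddAbove_coe_image (s : Set UI) : BddAbove ((↑) '' s : Set ℝ) :=
  ⟨1, by rintro _ ⟨t, -, rfl⟩; exact t.2.2⟩

lemma leftEnd_lt {f : Homeo01} (hf : IsPosBump f) {t : UI} (ht : t ∈ supt f) :
    leftEnd f < t := by
  have h' := symm_apply_mem_supt ht
  have h := hf.2 _ h'
  rw [Equiv.apply_symm_apply] at h
  exact (csInf_le (bddBelow_coe_image _) ⟨_, h', rfl⟩).trans_lt h

lemma lt_rightEnd {f : Homeo01} (hf : IsPosBump f) {t : UI} (ht : t ∈ supt f) :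
    (t : ℝ) < rightEnd f := by
  have h' : f t ∈ supt f := fun he => ht (f.injective he)
  have h : (t : ℝ) < f t := hf.2 _ ht
  exact h.trans_le (le_csSup (bddAbove_coe_image _) ⟨_, h', rfl⟩)

lemma supt_eq {f : Homeo01} (hf : IsPosBump f) :
    supt f = {t : UI | leftEnd f < (t : ℝ) ∧ (t : ℝ) < rightEnd f} := by
  ext t
  refine ⟨fun ht => ⟨leftEnd_lt hf ht, lt_rightEnd hf ht⟩, fun ht => ?_⟩
  have hc : IsConnected ((↑) '' supt f : Set ℝ) :=
    hf.1.2.image _ continuous_subtype_val.continuousOn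
  obtain ⟨s, hs, hst⟩ :=
    hc.Ioo_csInf_csSup_subset (bddBelow_coe_image _) (bddAbove_coe_image _) ht
  rwa [← Subtype.ext hst]

lemma endpoints_bounds {f : Homeo01} (hf : IsPosBump f) {x y : ℝ}
    (h : supt f = {t : UI | x < (t : ℝ) ∧ (t : ℝ) < y}) : 0 ≤ x ∧ x < y ∧ y ≤ 1 := by
  obtain ⟨t, ht⟩ := hf.1.2.1
  rw [h] at ht
  refine ⟨?_, ht.1.trans ht.2, ?_⟩
  · by_contra! hx
    refine zero_notMem_supt hf ?_
    rw [h]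
    exact ⟨hx, t.2.1.trans_lt ht.2⟩
  · by_contra! hy
    refine one_notMem_supt hf ?_
    rw [h]
    exact ⟨ht.1.trans_le t.2.2, hy⟩

lemma endpoints_unique {f : Homeo01} (hf : IsPosBump f) {x y : ℝ}
    (h : supt f = {t : UI | x < (t : ℝ) ∧ (t : ℝ) < y}) : x = leftEnd f ∧ y = rightEnd f := by
  obtain ⟨h0, hxy, h1⟩ := endpoints_bounds hf h
  have himg : ((↑) '' supt f : Set ℝ) = Ioo x y := by
    ext s
    constructor
    · rintro ⟨t, ht, rfl⟩
      rwa [h] at ht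
    · rintro hs
      refine ⟨⟨s, h0.trans hs.1.le, hs.2.le.trans h1⟩, ?_, rfl⟩
      rw [h]
      exact hs
  rw [leftEnd, rightEnd, himg, csInf_Ioo hxy, csSup_Ioo hxy]
  exact ⟨rfl, rfl⟩

lemma isLeftTransition_leftEnd {f : Homeo01} (hf : IsPosBump f) {t : UI}
    (ht : (t : ℝ) = leftEnd f) : IsLeftTransition f t := by
  obtain ⟨h0, hxy, h1⟩ := endpoints_bounds hf (supt_eq hf)
  refine ⟨fun h => (leftEnd_lt hf h).ne' ht, fun ε hε => ?_⟩
  obtain ⟨s, hs, hs'⟩ := exists_between (lt_min hxy (lt_add_of_pos_right (leftEnd f) hε))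
  obtain ⟨hs₁, hs₂⟩ := lt_min_iff.1 hs'
  refine ⟨⟨s, h0.trans hs.le, hs₁.le.trans h1⟩, ?_, ?_, ?_⟩
  · rw [supt_eq hf]
    exact ⟨hs, hs₁⟩
  · rw [← ht] at hs
    exact hs
  · rwa [ht]

lemma isRightTransition_rightEnd {f : Homeo01} (hf : IsPosBump f) {t : UI}
    (ht : (t : ℝ) = rightEnd f) : IsRightTransition f t := by
  obtain ⟨h0, hxy, h1⟩ := endpoints_bounds hf (supt_eq hf)
  refine ⟨fun h => (lt_rightEnd hf h).ne ht, fun ε hε => ?_⟩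
  obtain ⟨s, hs', hs⟩ := exists_between (max_lt hxy (sub_lt_self (rightEnd f) hε))
  obtain ⟨hs₁, hs₂⟩ := max_lt_iff.1 hs'
  refine ⟨⟨s, h0.trans hs₁.le, hs.le.trans h1⟩, ?_, ?_, ?_⟩
  · rw [supt_eq hf]
    exact ⟨hs₁, hs⟩
  · rw [← ht] at hs
    exact hs
  · rwa [ht]

lemma exists_coe_eq_leftEnd {f : Homeo01} (hf : IsPosBump f) : ∃ t : UI, (t : ℝ) = leftEnd f := by
  obtain ⟨h0, hxy, h1⟩ := endpoints_bounds hf (supt_eq hf)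
  exact ⟨⟨leftEnd f, h0, hxy.le.trans h1⟩, rfl⟩

lemma exists_coe_eq_rightEnd {f : Homeo01} (hf : IsPosBump f) :
    ∃ t : UI, (t : ℝ) = rightEnd f := by
  obtain ⟨h0, hxy, h1⟩ := endpoints_bounds hf (supt_eq hf)
  exact ⟨⟨rightEnd f, h0.trans hxy.le, h1⟩, rfl⟩

lemma GeomProper.eq_of_leftEnd_eq {A : Set Homeo01} (hprop : GeomProper A) {f g : Homeo01}
    (hfA : f ∈ A) (hgA : g ∈ A) (hf : IsPosBump f) (hg : IsPosBump g)
    (h : leftEnd f = leftEnd g) : f = g := by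
  by_contra hne
  obtain ⟨t, ht⟩ := exists_coe_eq_leftEnd hf
  exact hprop.1 f hfA g hgA hne t
    ⟨isLeftTransition_leftEnd hf ht, isLeftTransition_leftEnd hg (ht.trans h)⟩

lemma GeomProper.eq_of_rightEnd_eq {A : Set Homeo01} (hprop : GeomProper A) {f g : Homeo01}
    (hfA : f ∈ A) (hgA : g ∈ A) (hf : IsPosBump f) (hg : IsPosBump g)
    (h : rightEnd f = rightEnd g) : f = g := by
  by_contra hne
  obtain ⟨t, ht⟩ := exists_coe_eq_rightEnd hf
  exact hprop.2 f hfA g hgA hne t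
    ⟨isRightTransition_rightEnd hf ht, isRightTransition_rightEnd hg (ht.trans h)⟩

/-- `b` may directly follow `a` in a stretched transition chain of `A`. -/
def Linked (A : Set Homeo01) (a b : Homeo01) : Prop :=
  (leftEnd a < leftEnd b ∧ leftEnd b < rightEnd a ∧ rightEnd a < rightEnd b) ∧
  ∀ t : UI, leftEnd b < (t : ℝ) → (t : ℝ) < rightEnd a → ∀ f ∈ A, ¬ IsTransition f t

lemma Linked.leftEnd_le {A : Set Homeo01} {a b c : Homeo01} (hb : Linked A a b)
    (hc : Linked A a c) (hcA : c ∈ A) (hcb : IsPosBump c) : leftEnd c ≤ leftEnd b := by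
  by_contra! h
  obtain ⟨t, ht⟩ := exists_coe_eq_leftEnd hcb
  exact hb.2 t (ht ▸ h) (ht ▸ hc.1.2.1) c hcA (Or.inl (isLeftTransition_leftEnd hcb ht))

lemma Linked.le_rightEnd {A : Set Homeo01} {a b c : Homeo01} (hb : Linked A b a)
    (hc : Linked A c a) (hcA : c ∈ A) (hcb : IsPosBump c) : rightEnd b ≤ rightEnd c := by
  by_contra! h
  obtain ⟨t, ht⟩ := exists_coe_eq_rightEnd hcb
  exact hb.2 t (ht ▸ hc.1.2.1) (ht ▸ h) c hcA (Or.inr (isRightTransition_rightEnd hcb ht))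

lemma Linked.right_unique {A : Set Homeo01} (hA : ∀ a ∈ A, IsPosBump a) (hprop : GeomProper A)
    {a b c : Homeo01} (hbA : b ∈ A) (hcA : c ∈ A) (hb : Linked A a b) (hc : Linked A a c) :
    b = c :=
  hprop.eq_of_leftEnd_eq hbA hcA (hA b hbA) (hA c hcA)
    ((hc.leftEnd_le hb hbA (hA b hbA)).antisymm (hb.leftEnd_le hc hcA (hA c hcA)))

lemma Linked.left_unique {A : Set Homeo01} (hA : ∀ a ∈ A, IsPosBump a) (hprop : GeomProper A)
    {a b c : Homeo01} (hbA : b ∈ A) (hcA : c ∈ A) (hb : Linked A b a) (hc : Linked A c a) :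
    b = c :=
  hprop.eq_of_rightEnd_eq hbA hcA (hA b hbA) (hA c hcA)
    ((hb.le_rightEnd hc hcA (hA c hcA)).antisymm (hc.le_rightEnd hb hbA (hA b hbA)))

lemma chainSet_iff {A : Set Homeo01} (hA : ∀ a ∈ A, IsPosBump a) {S : Set Homeo01} :
    ChainSet A S ↔ ∃ (k : ℕ) (c : Fin (k + 1) → Homeo01),
      (∀ i, c i ∈ A ∧ ¬ IsolatedIn A (c i)) ∧
      (∀ i : Fin k, Linked A (c i.castSucc) (c i.succ)) ∧ S = Set.range c := by
  constructor
  · rintro ⟨k, c, x, y, ⟨hc, hs, hxy, ht⟩, rfl⟩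
    have hx : ∀ i, x i = leftEnd (c i) := fun i => (endpoints_unique (hA _ (hc i).1) (hs i)).1
    have hy : ∀ i, y i = rightEnd (c i) := fun i => (endpoints_unique (hA _ (hc i).1) (hs i)).2
    simp only [hx, hy] at hxy ht
    exact ⟨k, c, hc, fun i => ⟨hxy i, ht i⟩, rfl⟩
  · rintro ⟨k, c, hc, hl, rfl⟩
    exact ⟨k, c, fun i => leftEnd (c i), fun i => rightEnd (c i),
      ⟨hc, fun i => supt_eq (hA _ (hc i).1), fun i => (hl i).1, fun i => (hl i).2⟩, rfl⟩

lemma MaxChainSet.mem_of_linked {A : Set Homeo01} (hA : ∀ a ∈ A, IsPosBump a)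
    (hprop : GeomProper A) {S : Set Homeo01} (hS : MaxChainSet A S) {b d : Homeo01}
    (hb : b ∈ S) (hd : d ∈ A) (hdi : ¬ IsolatedIn A d) (hbd : Linked A b d) : d ∈ S := by
  obtain ⟨k, c, hc, hl, rfl⟩ := (chainSet_iff hA).1 hS.1
  obtain ⟨i, rfl⟩ := hb
  induction i using Fin.lastCases with
  | cast i => exact ⟨i.succ, (hl i).right_unique hA hprop (hc _).1 hd hbd⟩
  | last =>
    have hext : ChainSet A (Set.range (Fin.snoc c d : Fin (k + 2) → Homeo01)) := by
      refine (chainSet_iff hA).2 ⟨k + 1, Fin.snoc c d, fun i => ?_, fun i => ?_, rfl⟩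
      · induction i using Fin.lastCases with
        | cast i => simpa using hc i
        | last => simpa using ⟨hd, hdi⟩
      · induction i using Fin.lastCases with
        | cast i => simpa only [Fin.succ_castSucc, Fin.snoc_castSucc] using hl i
        | last => simpa only [Fin.succ_last, Fin.snoc_castSucc, Fin.snoc_last] using hbd
    rw [hS.2 _ hext fun _ ⟨i, hi⟩ => ⟨i.castSucc, by simpa using hi⟩]
    exact ⟨Fin.last _, by simp⟩

lemma MaxChainSet.mem_of_linked_left {A : Set Homeo01} (hA : ∀ a ∈ A, IsPosBump a)
    (hprop : GeomProper A) {S : Set Homeo01} (hS : MaxChainSet A S) {b d : Homeo01}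
    (hb : b ∈ S) (hd : d ∈ A) (hdi : ¬ IsolatedIn A d) (hdb : Linked A d b) : d ∈ S := by
  obtain ⟨k, c, hc, hl, rfl⟩ := (chainSet_iff hA).1 hS.1
  obtain ⟨i, rfl⟩ := hb
  induction i using Fin.cases with
  | succ i => exact ⟨i.castSucc, (hl i).left_unique hA hprop (hc _).1 hd hdb⟩
  | zero =>
    have hext : ChainSet A (Set.range (Fin.cons d c : Fin (k + 2) → Homeo01)) := by
      refine (chainSet_iff hA).2 ⟨k + 1, Fin.cons d c, fun i => ?_, fun i => ?_, rfl⟩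
      · induction i using Fin.cases with
        | succ i => simpa using hc i
        | zero => simpa using ⟨hd, hdi⟩
      · induction i using Fin.cases with
        | succ i => simpa only [← Fin.succ_castSucc, Fin.cons_succ] using hl i
        | zero => simpa only [Fin.castSucc_zero, Fin.cons_zero, Fin.cons_succ] using hdb
    rw [hS.2 _ hext fun _ ⟨i, hi⟩ => ⟨i.succ, by simpa using hi⟩]
    exact ⟨0, by simp⟩

lemma MaxChainSet.superset_of_mem {A : Set Homeo01} (hA : ∀ a ∈ A, IsPosBump a)
    (hprop : GeomProper A) {S T : Set Homeo01} (hS : MaxChainSet A S) (hT : ChainSet A T)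
    {a : Homeo01} (haS : a ∈ S) (haT : a ∈ T) : T ⊆ S := by
  obtain ⟨k, c, hc, hl, rfl⟩ := (chainSet_iff hA).1 hT
  obtain ⟨i, rfl⟩ := haT
  have hstep : ∀ j : Fin k, c j.castSucc ∈ S ↔ c j.succ ∈ S := fun j =>
    ⟨fun h => hS.mem_of_linked hA hprop h (hc _).1 (hc _).2 (hl j),
      fun h => hS.mem_of_linked_left hA hprop h (hc _).1 (hc _).2 (hl j)⟩
  have hzero : ∀ j, c j ∈ S ↔ c 0 ∈ S := fun j => by
    induction j using Fin.induction with
    | zero => rfl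
    | succ j ih => rw [← hstep, ih]
  rintro _ ⟨j, rfl⟩
  exact (hzero j).2 ((hzero i).1 haS)

lemma exists_maxChainSet_mem {A : Set Homeo01} (hA : ∀ a ∈ A, IsPosBump a) (hfin : A.Finite)
    {a : Homeo01} (ha : a ∈ A) (hai : ¬ IsolatedIn A a) : ∃ S, MaxChainSet A S ∧ a ∈ S := by
  have hF : {S | ChainSet A S}.Finite := by
    refine hfin.finite_subsets.subset ?_
    rintro _ ⟨k, c, x, y, hc, rfl⟩ _ ⟨i, rfl⟩
    exact (hc.1 i).1
  have ha' : ChainSet A {a} :=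
    (chainSet_iff hA).2 ⟨0, fun _ => a, fun _ => ⟨ha, hai⟩, fun i => i.elim0, by simp⟩
  obtain ⟨S, haS, hS⟩ := hF.exists_le_maximal ha'
  exact ⟨S, ⟨hS.prop, fun T hT hST => hS.eq_of_le hT hST⟩, haS rfl⟩

/-- **Proposition (StretchPartProp).** If `A` is a finite geometrically proper set of
positive bump functions, then the maximal stretched transition chains of `A`
partition the nonisolated elements of `A`. -/
theorem chain_partition (A : Set Homeo01) (hA : ∀ a ∈ A, IsPosBump a)
    (hfin : A.Finite) (hprop : GeomProper A) :
    ∀ a ∈ A, ¬ IsolatedIn A a →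
      ∃! S : Set Homeo01, MaxChainSet A S ∧ a ∈ S := by
  intro a ha hai
  obtain ⟨S, hS, haS⟩ := exists_maxChainSet_mem hA hfin ha hai
  exact ⟨S, ⟨hS, haS⟩, fun T ⟨hT, haT⟩ =>
    (hS.superset_of_mem hA hprop hT.1 haS haT).antisymm
      (hT.superset_of_mem hA hprop hS.1 haT haS)⟩

end PingPong
end

section
/- Let A be a (possibly infinite) geometrically fast set of positive bump functions in Homeo₊(I), equipped with a marking witnessing fastness. If x ∈ I and w is a nonempty word which is locally reduced at x, then either x ∈ src(w) or xw ∈ dest(w). -/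
open Set

namespace PingPong

theorem apply_mem_supt {a : Homeo01} {t : UI} (ht : t ∈ supt a) : a t ∈ supt a :=
  fun h => ht (a.injective h)

/-- A point moved by a symbol of `A^±` lies in its source or is mapped into its destination. -/
theorem mem_symSrc_or_apply_mem_symDest {A : Set Homeo01} (m : Homeo01 → UI)
    (hA : ∀ a ∈ A, IsOPH a) {b : Homeo01} (hb : b ∈ A ∨ b⁻¹ ∈ A) {t : UI} (ht : b t ≠ t) :
    t ∈ symSrc A m b ∨ b t ∈ symDest A m b := by
  by_cases hbA : b ∈ A
  · simp only [symSrc, symDest, if_pos hbA]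
    rcases lt_or_ge t (m b) with h | h
    · exact Or.inl ⟨ht, h⟩
    · exact Or.inr ⟨apply_mem_supt ht, hA b hbA h⟩
  · have hcA : b⁻¹ ∈ A := hb.resolve_left hbA
    simp only [symSrc, symDest, if_neg hbA]
    have hbt : b t ∈ supt b⁻¹ := by
      simpa [supt, eq_comm] using ht
    rcases lt_or_ge (b t) (m b⁻¹) with h | h
    · exact Or.inr ⟨hbt, h⟩
    · refine Or.inl ⟨by simpa using apply_mem_supt hbt, ?_⟩
      simpa using hA _ hcA h

/-- If the destination of a symbol meets the source of another, they are mutually inverse. -/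
theorem eq_inv_of_mem_symDest_of_mem_symSrc {A : Set Homeo01} {m : Homeo01 → UI}
    (hfd : FeetDisjoint A m) {a b : Homeo01} (ha : a ∈ A ∨ a⁻¹ ∈ A) (hb : b ∈ A ∨ b⁻¹ ∈ A)
    {t : UI} (htb : t ∈ symDest A m b) (hta : t ∈ symSrc A m a) : a = b⁻¹ := by
  have key : ∀ c ∈ A, ∀ d ∈ A, ∀ i j : Bool,
      t ∈ foot c (m c) i → t ∈ foot d (m d) j → (c, i) = (d, j) := by
    intro c hc d hd i j hi hj
    by_contra hne
    exact Set.disjoint_left.1 (hfd c hc d hd i j hne) hi hj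
  by_cases hbA : b ∈ A <;> by_cases haA : a ∈ A <;>
    simp only [symDest, symSrc, hbA, haA, if_true, if_false] at htb hta
  · simpa using key b hbA a haA true false htb hta
  · have h := key b hbA a⁻¹ (ha.resolve_left haA) true true htb hta
    simp only [Prod.mk.injEq, and_true] at h
    simp [h]
  · have h := key b⁻¹ (hb.resolve_left hbA) a haA false false htb hta
    simp only [Prod.mk.injEq, and_true] at h
    exact h.symm
  · simpa using key b⁻¹ (hb.resolve_left hbA) a⁻¹ (ha.resolve_left haA) false true htb hta

theorem LocallyReducedAt.of_append {u v : List Homeo01} {t : UI}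
    (h : LocallyReducedAt (u ++ v) t) : LocallyReducedAt u t :=
  ⟨(List.isChain_append.1 h.1).1, fun p a hp => h.2 p a (hp.trans (List.prefix_append u v))⟩

/-- **Lemma (PingPong).** For a geometrically fast marked set `A` of positive bumps:
if `w` is a nonempty `A`-word locally reduced at `x`, then `x ∈ src(w)` or
`xw ∈ dest(w)`. -/
theorem ping_pong (A : Set Homeo01) (m : Homeo01 → UI)
    (hA : ∀ a ∈ A, IsPosBump a) (hm : IsMarking A m) (hfd : FeetDisjoint A m)
    (x : UI) (w : List Homeo01) (hw : WordOn A w) (hne : w ≠ [])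
    (hlr : LocallyReducedAt w x) :
    x ∈ wordSrc A m w ∨ act x w ∈ wordDest A m w := by
  induction w using List.reverseRecOn with
  | nil => exact absurd rfl hne
  | append_singleton u a ih =>
    have ha : a ∈ A ∨ a⁻¹ ∈ A := hw a (by simp)
    have hstep := mem_symSrc_or_apply_mem_symDest m (fun c hc => (hA c hc).1.1) ha
      (hlr.2 u a (List.prefix_refl _))
    have hdest : wordDest A m (u ++ [a]) = symDest A m a := by simp [wordDest]
    have hact : act x (u ++ [a]) = a (act x u) := by simp [act]
    rw [hdest, hact]
    rcases List.eq_nil_or_concat u with rfl | ⟨v, b, rfl⟩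
    · exact hstep
    rw [List.concat_eq_append] at *
    have hb : b ∈ A ∨ b⁻¹ ∈ A := hw b (by simp)
    have hsrc : wordSrc A m (v ++ [b] ++ [a]) = wordSrc A m (v ++ [b]) := by
      cases v <;> rfl
    rw [hsrc]
    refine (ih (fun c hc => hw c (List.mem_append_left _ hc)) (by simp)
      hlr.of_append).imp_right fun hvb => hstep.resolve_left fun hsa => ?_
    have hvb' : act x (v ++ [b]) ∈ symDest A m b := by simpa [wordDest] using hvb
    refine (List.isChain_append.1 hlr.1).2.2 b (by simp) a (by simp) ?_
    exact eq_inv_of_mem_symDest_of_mem_symSrc hfd ha hb hvb' hsa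

end PingPong
end

section
/- Let A be a (possibly infinite) geometrically fast set of positive bump functions in Homeo₊(I), equipped with a marking witnessing fastness. If s ≠ t are points of I which both have trivial history, then the orbit of s under ⟨A⟩ and the orbit of t under ⟨A⟩ are disjoint. -/
open Set

namespace PingPong

/-- The signed symbol `a^{±1}`: `true` gives `a`, `false` gives `a⁻¹`. With this convention the
destination of the symbol is `foot a (m a) i` and its source is `foot a (m a) (!i)`. -/
def signed (a : Homeo01) : Bool → Homeo01
  | false => a⁻¹
  | true => a

lemma signed_not_apply_signed (a : Homeo01) (i : Bool) (x : UI) :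
    signed a (!i) (signed a i x) = x := by
  cases i <;> simp [signed]

/-- A symbol maps the part of its support outside its source into its destination. -/
lemma signed_apply_mem_foot {a : Homeo01} (ha : IsOPH a) (t : UI) (i : Bool) {x : UI}
    (hx : signed a i x ≠ x) (hsrc : x ∉ foot a t (!i)) : signed a i x ∈ foot a t i := by
  cases i
  · have hx' : a x ≠ x := fun h => hx (Equiv.Perm.inv_eq_iff_eq.2 h.symm)
    have hlt : x < a t := lt_of_not_ge fun h => hsrc ⟨hx', h⟩
    refine ⟨?_, lt_of_not_ge fun h => ?_⟩
    · simpa [supt, signed] using hx.symm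
    · have hle : a t ≤ a (a⁻¹ x) := ha h
      rw [show a (a⁻¹ x) = x from a.apply_symm_apply x] at hle
      exact hle.not_gt hlt
  · have hle : t ≤ x := le_of_not_gt fun h => hsrc ⟨hx, h⟩
    exact ⟨fun h => hx (a.injective h), ha hle⟩

/-- `ReducedReach A t o x`: the point `x` is the image of `t` under some word on `A` that is
locally reduced at `t`, whose last symbol is `o` (`none` for the empty word). -/
inductive ReducedReach (A : Set Homeo01) (t : UI) : Option (Homeo01 × Bool) → UI → Prop
  | nil : ReducedReach A t none t
  | snoc {o : Option (Homeo01 × Bool)} {x : UI} {a : Homeo01} {i : Bool} :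
      ReducedReach A t o x → a ∈ A → signed a i x ≠ x → o ≠ some (a, !i) →
      ReducedReach A t (some (a, i)) (signed a i x)

lemma ReducedReach.exists_signed_apply {A : Set Homeo01} {t : UI} {o : Option (Homeo01 × Bool)}
    {x : UI} (h : ReducedReach A t o x) {a : Homeo01} (ha : a ∈ A) (i : Bool) :
    ∃ o', ReducedReach A t o' (signed a i x) := by
  by_cases hx : signed a i x = x
  · exact ⟨o, by rwa [hx]⟩
  by_cases ho : o = some (a, !i)
  · subst ho
    cases h with
    | @snoc o' y _ _ hy _ _ _ =>
      refine ⟨o', ?_⟩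
      have := signed_not_apply_signed a (!i) y
      rw [Bool.not_not] at this
      rwa [this]
  · exact ⟨_, h.snoc ha hx ho⟩

lemma exists_reducedReach {A : Set Homeo01} {g : Homeo01} (hg : g ∈ Subgroup.closure A) (t : UI) :
    ∃ o, ReducedReach A t o (g t) := by
  induction hg using Subgroup.closure_induction_left with
  | one => exact ⟨none, .nil⟩
  | mul_left a ha g _ ih => exact ih.elim fun _ h => h.exists_signed_apply ha true
  | inv_mul_cancel a ha g _ ih => exact ih.elim fun _ h => h.exists_signed_apply ha false

/-- From a point with trivial history, the only foot containing the endpoint of a locally reduced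
word is the destination of its last symbol. -/
lemma ReducedReach.mem_foot_iff {A : Set Homeo01} {m : Homeo01 → UI}
    (hA : ∀ a ∈ A, IsPosBump a) (hfd : FeetDisjoint A m) {t : UI} (ht : TrivialHistory A m t)
    {o : Option (Homeo01 × Bool)} {x : UI} (h : ReducedReach A t o x) {b : Homeo01} (hb : b ∈ A)
    (j : Bool) : x ∈ foot b (m b) j ↔ o = some (b, j) := by
  induction h generalizing b j with
  | nil => cases j <;> simp [foot, ht b hb]
  | @snoc o x a i _ ha hx ho ih =>
    have hmem : signed a i x ∈ foot a (m a) i :=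
      signed_apply_mem_foot (hA a ha).1.1 _ _ hx fun h => ho ((ih ha _).1 h)
    refine ⟨fun h => ?_, fun h => ?_⟩
    · by_contra hne
      exact Set.disjoint_left.1 (hfd a ha b hb i j fun h => hne (congrArg some h)) hmem h
    · obtain ⟨rfl, rfl⟩ := Prod.mk.inj (Option.some.inj h)
      exact hmem

/-- **Lemma (DisjointOrbits).** For a geometrically fast marked set `A` of positive
bumps: if `s ≠ t` both have trivial history, then the `⟨A⟩`-orbits of `s` and `t`
are disjoint. -/
theorem disjoint_orbits (A : Set Homeo01) (m : Homeo01 → UI)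
    (hA : ∀ a ∈ A, IsPosBump a) (hm : IsMarking A m) (hfd : FeetDisjoint A m)
    (s t : UI) (hst : s ≠ t)
    (hs : TrivialHistory A m s) (ht : TrivialHistory A m t) :
    ∀ g ∈ Subgroup.closure A, ∀ h ∈ Subgroup.closure A, g s ≠ h t := by
  intro g hg h hh heq
  obtain ⟨o, ho⟩ := exists_reducedReach (mul_mem (inv_mem hg) hh) t
  have hgs : (g⁻¹ * h) t = s :=
    Equiv.Perm.inv_eq_iff_eq.2 heq.symm
  rw [hgs] at ho
  cases ho with
  | nil => exact hst rfl
  | @snoc _ _ a i hr ha hx hne =>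
    have hmem := ((hr.snoc ha hx hne).mem_foot_iff hA hfd ht ha i).2 rfl
    cases i
    · exact (hs a ha).1 hmem
    · exact (hs a ha).2 hmem

end PingPong
end
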